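/- Every salami has exactly two ends. That is, if G=(V,w,m,d) is a connected, locally finite weighted graph with a path metric d with finite balls, non-negative Ollivier curvature on all edges, and a salami partition, then G has exactly two ends. -/

import Mathlib

open Filter

namespace SalamiPaper

variable {V : Type*}

/-- Locally finite: every vertex has finitely many neighbors. -/
def LocallyFinite (w : V → V → ℝ) : Prop := ∀ x : V, {y | 0 < w x y}.Finite

/-- Connectedness of the weighted graph: any two vertices are joined by a path. -/
def GraphConnected (w : V → V → ℝ) : Prop :=
  ∀ x y : V, Relation.ReflTransGen (fun a b => 0 < w a b) x y

/-- The weighted graph Laplacian `Δf(x) = (1/m(x)) ∑_y w(x,y)(f(y)-f(x))`. -/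
noncomputable def lap (w : V → V → ℝ) (m : V → ℝ) (f : V → ℝ) (x : V) : ℝ :=
  (m x)⁻¹ * ∑ᶠ y, w x y * (f y - f x)

/-- The vertex degree `Deg(x) = (1/m(x)) ∑_y w(x,y)`. -/
noncomputable def deg (w : V → V → ℝ) (m : V → ℝ) (x : V) : ℝ :=
  (m x)⁻¹ * ∑ᶠ y, w x y

/-- The set of `d`-lengths of adjacency paths from `x` to `y`. -/
def pathLens (w : V → V → ℝ) (d : V → V → ℝ) (x y : V) : Set ℝ :=
  {L | ∃ (n : ℕ) (p : ℕ → V), p 0 = x ∧ p n = y ∧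
    (∀ i < n, 0 < w (p i) (p (i + 1))) ∧
    L = ∑ i ∈ Finset.range n, d (p i) (p (i + 1))}

/-- `d` is a path metric on the graph with edge weight `w`. -/
def IsPathMetric (w : V → V → ℝ) (d : V → V → ℝ) : Prop :=
  (∀ x, d x x = 0) ∧ (∀ x y, x ≠ y → 0 < d x y) ∧ (∀ x y, d x y = d y x) ∧
  (∀ x y z, d x z ≤ d x y + d y z) ∧
  (∀ x y, d x y = sInf (pathLens w d x y))

/-- All balls are finite. -/
def FiniteBalls (d : V → V → ℝ) : Prop := ∀ (x : V) (R : ℝ), {y | d x y ≤ R}.Finite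

/-- The combinatorial graph distance (as a real number). -/
noncomputable def combDist (w : V → V → ℝ) (x y : V) : ℝ :=
  sInf {L | ∃ (n : ℕ) (p : ℕ → V), p 0 = x ∧ p n = y ∧
    (∀ i < n, 0 < w (p i) (p (i + 1))) ∧ L = (n : ℝ)}

/-- `Lip(1)`: the 1-Lipschitz functions with respect to `d`. -/
def Lip1 (d : V → V → ℝ) (f : V → ℝ) : Prop := ∀ x y, f y - f x ≤ d x y

/-- The Ollivier curvature
`κ(x,y) = (1/d(x,y)) inf{Δf(x) - Δf(y) : f ∈ Lip(1), f(y)-f(x) = d(x,y)}`. -/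
noncomputable def kappa (w : V → V → ℝ) (m : V → ℝ) (d : V → V → ℝ) (x y : V) : ℝ :=
  (d x y)⁻¹ * sInf {c | ∃ f : V → ℝ, Lip1 d f ∧ f y - f x = d x y ∧
    c = lap w m f x - lap w m f y}

/-- `m(A) = ∞`: the total measure of `A` is infinite. -/
def InfVolume (m : V → ℝ) (A : Set V) : Prop :=
  ∀ c : ℝ, ∃ F : Finset V, ↑F ⊆ A ∧ c < ∑ x ∈ F, m x

/-- A salami partition `(X,Y,K)`. -/
def SalamiPartition (w : V → V → ℝ) (m : V → ℝ) (X Y K : Set V) : Prop :=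
  X ∪ Y ∪ K = Set.univ ∧ Disjoint X Y ∧ Disjoint X K ∧ Disjoint Y K ∧
  K.Finite ∧ (∀ x ∈ X, ∀ y ∈ Y, w x y = 0) ∧ InfVolume m X ∧ InfVolume m Y

/-- Reachability inside a subset `A` of the vertex set. -/
def reachIn (w : V → V → ℝ) (A : Set V) : V → V → Prop :=
  Relation.ReflTransGen (fun a b => a ∈ A ∧ b ∈ A ∧ 0 < w a b)

/-- The induced subgraph on `A` is connected. -/
def ConnectedIn (w : V → V → ℝ) (A : Set V) : Prop :=
  ∀ x ∈ A, ∀ y ∈ A, reachIn w A x y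

/-- A connected salami partition: `K` induces a connected subgraph. -/
def ConnectedSalamiPartition (w : V → V → ℝ) (m : V → ℝ) (X Y K : Set V) : Prop :=
  SalamiPartition w m X Y K ∧ ConnectedIn w K

/-- The basic standing assumptions on a weighted graph `G = (V,w,m,d)`:
countable vertex set, symmetric non-negative edge weight vanishing on the diagonal,
positive vertex measure, local finiteness, connectedness,
`d` a path metric with finite balls. -/
def IsGraphBase (w : V → V → ℝ) (m : V → ℝ) (d : V → V → ℝ) : Prop :=
  Countable V ∧ (∀ x y, w x y = w y x) ∧ (∀ x y, 0 ≤ w x y) ∧ (∀ x, w x x = 0) ∧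
  (∀ x, 0 < m x) ∧ LocallyFinite w ∧ GraphConnected w ∧
  IsPathMetric w d ∧ FiniteBalls d

/-- Non-negative Ollivier curvature on all edges. -/
def NonnegCurv (w : V → V → ℝ) (m : V → ℝ) (d : V → V → ℝ) : Prop :=
  ∀ x y, 0 < w x y → 0 ≤ kappa w m d x y

/-- A salami: a connected, locally finite weighted graph with a path metric with
finite balls, non-negative Ollivier curvature, admitting a salami partition. -/
def IsSalami (w : V → V → ℝ) (m : V → ℝ) (d : V → V → ℝ) : Prop :=
  IsGraphBase w m d ∧ NonnegCurv w m d ∧ ∃ X Y K : Set V, SalamiPartition w m X Y K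

/-- `G` has at least `n` ends: there is a finite set `K` such that `V ∖ K` has at
least `n` infinite connected components. -/
def atLeastEnds (w : V → V → ℝ) (n : ℕ) : Prop :=
  ∃ K : Set V, K.Finite ∧ ∃ x : Fin n → V,
    (∀ i, x i ∉ K) ∧ (∀ i, {y | reachIn w Kᶜ (x i) y}.Infinite) ∧
    (∀ i j, i ≠ j → ¬ reachIn w Kᶜ (x i) (x j))

/-- `Lip(1,K)`: functions that are 1-Lipschitz on `K`. -/
def Lip1On (d : V → V → ℝ) (K : Set V) (f : V → ℝ) : Prop :=
  ∀ x ∈ K, ∀ y ∈ K, f y - f x ≤ d x y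

open Classical in
/-- The extremal Lipschitz extension operator `S(P)` of the salami partition
`P = (X,Y,K)`. -/
noncomputable def Sop (d : V → V → ℝ) (X Y K : Set V) (f : V → ℝ) : V → ℝ :=
  fun v =>
    if v ∈ K then f v
    else if v ∈ X then sSup {c | ∃ u ∈ K, c = f u - d v u}
    else sInf {c | ∃ u ∈ K, c = f u + d v u}

/-- `ℱ(P) = S(P)(Lip(1,K))`. -/
def calF (d : V → V → ℝ) (X Y K : Set V) : Set (V → ℝ) :=
  {g | ∃ f : V → ℝ, Lip1On d K f ∧ g = Sop d X Y K f}

/-- `ℋ(P)`: the harmonic functions in `ℱ(P)`. -/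
def calH (w : V → V → ℝ) (m : V → ℝ) (d : V → V → ℝ) (X Y K : Set V) :
    Set (V → ℝ) :=
  {g | g ∈ calF d X Y K ∧ ∀ x, lap w m g x = 0}

/-- `∇₊f(x) = max_{y∼x} (f(y)-f(x))/d(x,y)`. -/
noncomputable def gradPlus (w : V → V → ℝ) (d : V → V → ℝ) (f : V → ℝ) (x : V) : ℝ :=
  sSup {c | ∃ y, 0 < w x y ∧ c = (f y - f x) / d x y}

/-- `∇₋f(x) = max_{y∼x} (f(x)-f(y))/d(x,y)`. -/
noncomputable def gradMinus (w : V → V → ℝ) (d : V → V → ℝ) (f : V → ℝ) (x : V) : ℝ :=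
  sSup {c | ∃ y, 0 < w x y ∧ c = (f x - f y) / d x y}

/-- `|∇f|(x) = max_{y∼x} |f(y)-f(x)|/d(x,y)`. -/
noncomputable def gradAbs (w : V → V → ℝ) (d : V → V → ℝ) (f : V → ℝ) (x : V) : ℝ :=
  sSup {c | ∃ y, 0 < w x y ∧ c = |f y - f x| / d x y}

/-- Recurrence: for every `ε > 0` there is a finitely supported `f` with
`‖f‖∞ = 1` and `-⟨f, Δf⟩ < ε`. -/
def Recurrent (w : V → V → ℝ) (m : V → ℝ) : Prop :=
  ∀ ε : ℝ, 0 < ε → ∃ f : V → ℝ, (Function.support f).Finite ∧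
    (∀ x, |f x| ≤ 1) ∧ (∃ x, |f x| = 1) ∧
    -(∑ᶠ x, f x * lap w m f x * m x) < ε

open Classical in
/-- `∑_{x,y : f(y) < 0 ≤ f(x)} w(x,y)(f(x)-f(y))`. -/
noncomputable def cutSum (w : V → V → ℝ) (f : V → ℝ) : ℝ :=
  ∑ᶠ p : V × V, if f p.2 < 0 ∧ 0 ≤ f p.1 then w p.1 p.2 * (f p.1 - f p.2) else 0

/-- Subexponential growth: `max_{B_r(x)} |u| = e^{o(r)}` as `r → ∞`. -/
def SubexpGrowth (d : V → V → ℝ) (x : V) (u : V → ℝ) : Prop :=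
  Filter.Tendsto
    (fun r : ℕ => Real.log (sSup {c | ∃ y, d x y ≤ (r : ℝ) ∧ c = |u y|}) / (r : ℝ))
    Filter.atTop (nhds 0)


/-- A finite set `K` separating the two remaining parts `X` and `Y` of the graph. -/
structure Separation (w : V → V → ℝ) (X Y K : Set V) : Prop where
  cover : ∀ v, v ∈ X ∨ v ∈ Y ∨ v ∈ K
  left_not_right : ∀ v ∈ X, v ∉ Y
  left_not_mid : ∀ v ∈ X, v ∉ K
  right_not_mid : ∀ v ∈ Y, v ∉ K
  finite : K.Finite
  noEdge : ∀ x ∈ X, ∀ y ∈ Y, w x y = 0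

/-- A `1`-Lipschitz function which is the smallest `1`-Lipschitz extension of `f|_K` to `X`
and the largest one to `Y`. -/
structure Extremal (d : V → V → ℝ) (X Y K : Set V) (f : V → ℝ) : Prop where
  lip : Lip1 d f
  lower : ∀ v ∈ X, ∃ u ∈ K, f v = f u - d u v
  upper : ∀ v ∈ Y, ∃ u ∈ K, f v = f u + d u v

theorem Separation.symm {w : V → V → ℝ} {X Y K : Set V} (hw : ∀ x y, w x y = w y x)
    (h : Separation w X Y K) : Separation w Y X K where
  cover v := by rcases h.cover v with h | h | h <;> simp [h]
  left_not_right v hv hv' := h.left_not_right v hv' hv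
  left_not_mid := h.right_not_mid
  right_not_mid := h.left_not_mid
  finite := h.finite
  noEdge x hx y hy := by rw [hw, h.noEdge y hy x hx]

theorem Extremal.neg {d : V → V → ℝ} {X Y K : Set V} {f : V → ℝ}
    (hd : ∀ x y, d x y = d y x) (h : Extremal d X Y K f) :
    Extremal d Y X K (fun v => -f v) where
  lip x y := by have := h.lip y x; rw [hd y x] at this; linarith
  lower v hv := by
    obtain ⟨u, hu, e⟩ := h.upper v hv
    exact ⟨u, hu, by rw [e]; ring⟩
  upper v hv := by
    obtain ⟨u, hu, e⟩ := h.lower v hv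
    exact ⟨u, hu, by rw [e]; ring⟩

section Laplacian

variable {w : V → V → ℝ} {m : V → ℝ}

theorem finsum_weight_mul (hw : ∀ x y, 0 ≤ w x y) {x : V} (T : Finset V)
    (hT : ∀ y, 0 < w x y → y ∈ T) (g : V → ℝ) :
    ∑ᶠ y, w x y * g y = ∑ y ∈ T, w x y * g y := by
  apply finsum_eq_sum_of_support_subset
  intro y hy
  apply hT
  rcases (hw x y).lt_or_eq with h | h
  · exact h
  · simp [← h] at hy

theorem lap_eq_sum (hw : ∀ x y, 0 ≤ w x y) {x : V} (T : Finset V)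
    (hT : ∀ y, 0 < w x y → y ∈ T) (f : V → ℝ) :
    lap w m f x = (m x)⁻¹ * ∑ y ∈ T, w x y * (f y - f x) := by
  rw [lap, finsum_weight_mul hw T hT]

theorem lap_neg (f : V → ℝ) (x : V) : lap w m (fun v => -f v) x = -lap w m f x := by
  unfold lap
  rw [← mul_neg, ← finsum_neg_distrib]
  congr 2
  ext y
  ring

theorem continuous_lap (hw : ∀ x y, 0 ≤ w x y) (hl : LocallyFinite w) (x : V) :
    Continuous fun f : V → ℝ => lap w m f x := by
  have : (fun f : V → ℝ => lap w m f x) =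
      fun f => (m x)⁻¹ * ∑ y ∈ (hl x).toFinset, w x y * (f y - f x) := by
    ext f
    exact lap_eq_sum hw _ (by simp) f
  rw [this]
  fun_prop

/-- If `f - g` is minimal at `x`, up to an error `δ`, then `Δg(x) - δ Deg(x) ≤ Δf(x)`. -/
theorem lap_sub_le (hw : ∀ x y, 0 ≤ w x y) (hl : LocallyFinite w) (hm : ∀ x, 0 < m x)
    {f g : V → ℝ} {x : V} (δ : ℝ) (h : ∀ y, g y - g x - δ ≤ f y - f x) :
    lap w m g x - δ * deg w m x ≤ lap w m f x := by
  have hT : ∀ y, 0 < w x y → y ∈ (hl x).toFinset := by simp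
  have h1 := finsum_weight_mul hw _ hT (fun _ => 1)
  simp only [mul_one] at h1
  rw [lap_eq_sum hw _ hT, lap_eq_sum hw _ hT, deg, h1, mul_left_comm, ← mul_sub,
    Finset.mul_sum, ← Finset.sum_sub_distrib]
  refine mul_le_mul_of_nonneg_left (Finset.sum_le_sum fun y _ => ?_) (inv_pos.2 (hm x)).le
  nlinarith [mul_le_mul_of_nonneg_left (h y) (hw x y)]

theorem lap_le_lap (hw : ∀ x y, 0 ≤ w x y) (hl : LocallyFinite w) (hm : ∀ x, 0 < m x)
    {f g : V → ℝ} {x : V} (h : ∀ y, g y - g x ≤ f y - f x) :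
    lap w m g x ≤ lap w m f x := by
  simpa using lap_sub_le hw hl hm 0 (by simpa using h)

theorem lap_lt_lap (hw : ∀ x y, 0 ≤ w x y) (hl : LocallyFinite w) (hm : ∀ x, 0 < m x)
    {f g : V → ℝ} {x z : V} (h : ∀ y, g y - g x ≤ f y - f x) (hz : 0 < w x z)
    (hlt : g z - g x < f z - f x) :
    lap w m g x < lap w m f x := by
  have hT : ∀ y, 0 < w x y → y ∈ (hl x).toFinset := by simp
  rw [lap_eq_sum hw _ hT, lap_eq_sum hw _ hT]
  refine mul_lt_mul_of_pos_left (Finset.sum_lt_sum (fun y _ => ?_) ⟨z, hT z hz, ?_⟩)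
    (inv_pos.2 (hm x))
  · exact mul_le_mul_of_nonneg_left (h y) (hw x y)
  · exact mul_lt_mul_of_pos_left hlt hz

end Laplacian

section Geometry

variable {w : V → V → ℝ} {m : V → ℝ} {d : V → V → ℝ}

/-- Any two distinct points are joined by a geodesic: one can make a first step of it. -/
theorem exists_adj_dist_add (hb : IsGraphBase w m d) {x y : V} (hxy : x ≠ y) :
    ∃ z, 0 < w x z ∧ 0 < d x z ∧ d x z + d z y = d x y := by
  obtain ⟨-, -, -, hw0, -, hl, -, ⟨hd0, hdpos, -, htri, hinf⟩, -⟩ := hb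
  have key : ∀ (p : ℕ → V) (n : ℕ), d (p 0) (p n) ≤
      ∑ i ∈ Finset.range n, d (p i) (p (i + 1)) := by
    intro p n
    induction n with
    | zero => simp [hd0]
    | succ n ih =>
      rw [Finset.sum_range_succ]
      linarith [htri (p 0) (p n) (p (n + 1))]
  have hne : (pathLens w d x y).Nonempty := by
    by_contra hcon
    rw [Set.not_nonempty_iff_eq_empty] at hcon
    have := hinf x y
    rw [hcon, Real.sInf_empty] at this
    linarith [hdpos x y hxy]
  have hstep : ∀ L ∈ pathLens w d x y, ∃ z, 0 < w x z ∧ d x z + d z y ≤ L := by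
    rintro L ⟨n, p, rfl, rfl, hadj, rfl⟩
    obtain _ | n := n
    · exact absurd rfl hxy
    · refine ⟨p 1, hadj 0 (by omega), ?_⟩
      rw [Finset.sum_range_succ']
      have := key (fun i => p (i + 1)) n
      simp only [zero_add] at this ⊢
      linarith
  obtain ⟨L, hL⟩ := hne
  obtain ⟨z₀, hz₀, -⟩ := hstep L hL
  obtain ⟨z, hz, hmin⟩ := Set.exists_min_image {z | 0 < w x z} (fun z => d x z + d z y)
    (hl x) ⟨z₀, hz₀⟩
  refine ⟨z, hz, hdpos x z ?_, le_antisymm ?_ (htri _ _ _)⟩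
  · rintro rfl
    exact absurd (hw0 x) (ne_of_gt hz)
  · rw [hinf x y]
    refine le_csInf ⟨L, hL⟩ fun L' hL' => ?_
    obtain ⟨z', hz', hle⟩ := hstep L' hL'
    exact (hmin z' hz').trans hle

theorem lap_anti_of_adj (hb : IsGraphBase w m d) (hk : NonnegCurv w m d) {f : V → ℝ}
    (hf : Lip1 d f) {x y : V} (hxy : 0 < w x y) (he : f y - f x = d x y) :
    lap w m f y ≤ lap w m f x := by
  obtain ⟨-, -, hw, hw0, hm, hl, -, ⟨-, hdpos, hdsymm, -, -⟩, -⟩ := hb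
  have hne : x ≠ y := by
    rintro rfl
    exact absurd (hw0 x) (ne_of_gt hxy)
  have hbound : ∀ (g : V → ℝ) (v : V), Lip1 d g →
      |lap w m g v| ≤ (m v)⁻¹ * ∑ u ∈ (hl v).toFinset, w v u * d v u := by
    intro g v hg
    rw [lap_eq_sum hw (hl v).toFinset (by simp), abs_mul, abs_of_pos (inv_pos.2 (hm v))]
    refine mul_le_mul_of_nonneg_left ((Finset.abs_sum_le_sum_abs _ _).trans
      (Finset.sum_le_sum fun u _ => ?_)) (inv_pos.2 (hm v)).le
    rw [abs_mul, abs_of_nonneg (hw v u)]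
    refine mul_le_mul_of_nonneg_left (abs_le.2 ⟨?_, hg v u⟩) (hw v u)
    have := hg u v
    rw [hdsymm u v] at this
    linarith
  have hbdd : BddBelow {c | ∃ f : V → ℝ, Lip1 d f ∧ f y - f x = d x y ∧
      c = lap w m f x - lap w m f y} := by
    refine ⟨-((m x)⁻¹ * ∑ u ∈ (hl x).toFinset, w x u * d x u) -
      (m y)⁻¹ * ∑ u ∈ (hl y).toFinset, w y u * d y u, ?_⟩
    rintro c ⟨g, hg, -, rfl⟩
    have h1 := (abs_le.1 (hbound g x hg)).1
    have h2 := (abs_le.1 (hbound g y hg)).2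
    linarith
  have h0 := hk x y hxy
  rw [kappa, mul_nonneg_iff_of_pos_left (inv_pos.2 (hdpos x y hne))] at h0
  have := h0.trans (csInf_le hbdd ⟨f, hf, he, rfl⟩)
  linarith

/-- Nonnegative curvature: the Laplacian of a `1`-Lipschitz function decreases along its
ascending gradient lines. -/
theorem lap_anti (hb : IsGraphBase w m d) (hk : NonnegCurv w m d) {f : V → ℝ}
    (hf : Lip1 d f) {x y : V} (he : f y - f x = d x y) :
    lap w m f y ≤ lap w m f x := by
  have hd := hb.2.2.2.2.2.2.2.1
  by_contra! hlt
  have hfin : {v | f y - f v = d v y ∧ lap w m f v < lap w m f y ∧ d v y ≤ d x y}.Finite := by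
    refine (hb.2.2.2.2.2.2.2.2 y (d x y)).subset ?_
    rintro v ⟨-, -, h⟩
    rw [hd.2.2.1] at h
    exact h
  obtain ⟨v, ⟨hv1, hv2, hv3⟩, hmin⟩ := Set.exists_min_image _ (fun v => d v y) hfin
    ⟨x, he, hlt, le_rfl⟩
  have hvy : v ≠ y := by
    rintro rfl
    exact lt_irrefl _ hv2
  obtain ⟨z, hz, hz0, hadd⟩ := exists_adj_dist_add hb hvy
  have h1 := hf v z
  have h2 := hf z y
  have h3 := lap_anti_of_adj hb hk hf hz (by linarith)
  have := hmin z ⟨by linarith, by linarith, by linarith⟩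
  linarith

/-- A geodesic between the two sides of a separation meets the separating set. -/
theorem Separation.exists_mid (hb : IsGraphBase w m d) {X Y K : Set V}
    (hs : Separation w X Y K) {x y : V} (hx : x ∈ X) (hy : y ∈ Y) :
    ∃ u ∈ K, d x u + d u y = d x y := by
  obtain ⟨hd0, -, hdsymm, htri, -⟩ := hb.2.2.2.2.2.2.2.1
  have hfin : {v | v ∈ X ∧ d x v + d v y = d x y}.Finite := by
    refine (hb.2.2.2.2.2.2.2.2 y (d x y)).subset ?_
    rintro v ⟨-, h⟩
    have := htri x v x
    rw [hd0, hdsymm v x] at this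
    have : d y v ≤ d x y := by
      rw [hdsymm y v]
      linarith
    exact this
  obtain ⟨v, ⟨hv1, hv2⟩, hmin⟩ := Set.exists_min_image _ (fun v => d v y) hfin
    ⟨x, hx, by simp [hd0]⟩
  have hvy : v ≠ y := by
    rintro rfl
    exact hs.left_not_right v hv1 hy
  obtain ⟨z, hz, hz0, hadd⟩ := exists_adj_dist_add hb hvy
  have hxz : d x z + d z y = d x y := by
    linarith [htri x v z, htri x z y]
  rcases hs.cover z with h | h | h
  · have := hmin z ⟨h, hxz⟩
    linarith
  · rw [hs.noEdge v hv1 z h] at hz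
    exact absurd hz (lt_irrefl _)
  · exact ⟨z, h, hxz⟩

/-- Extremal Lipschitz extension. -/
theorem Separation.exists_extremal (hb : IsGraphBase w m d) {X Y K : Set V}
    (hs : Separation w X Y K) (hK : K.Nonempty) {f : V → ℝ} (hf : Lip1On d K f) :
    ∃ g, Extremal d X Y K g ∧ ∀ u ∈ K, g u = f u := by
  classical
  obtain ⟨hd0, -, hdsymm, htri, -⟩ := hb.2.2.2.2.2.2.2.1
  have hL : ∀ v, ∃ a : ℝ, (∃ u ∈ K, a = f u - d u v) ∧ ∀ u ∈ K, f u - d u v ≤ a := by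
    intro v
    obtain ⟨u, hu, h⟩ := Set.exists_max_image K (fun u => f u - d u v) hs.finite hK
    exact ⟨_, ⟨u, hu, rfl⟩, h⟩
  have hU : ∀ v, ∃ a : ℝ, (∃ u ∈ K, a = f u + d u v) ∧ ∀ u ∈ K, a ≤ f u + d u v := by
    intro v
    obtain ⟨u, hu, h⟩ := Set.exists_min_image K (fun u => f u + d u v) hs.finite hK
    exact ⟨_, ⟨u, hu, rfl⟩, h⟩
  choose L hL1 hL2 using hL
  choose U hU1 hU2 using hU
  have lipL : Lip1 d L := by
    intro x y
    obtain ⟨u, hu, e⟩ := hL1 y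
    have h1 := hL2 x u hu
    have h2 := htri u y x
    rw [hdsymm y x] at h2
    linarith
  have lipU : Lip1 d U := by
    intro x y
    obtain ⟨u, hu, e⟩ := hU1 x
    have h1 := hU2 y u hu
    have h2 := htri u x y
    linarith
  have hLU : ∀ v, L v ≤ U v := by
    intro v
    obtain ⟨u, hu, e⟩ := hL1 v
    obtain ⟨u', hu', e'⟩ := hU1 v
    have h1 := hf u' hu' u hu
    have h2 := htri u' v u
    rw [hdsymm v u] at h2
    linarith
  have hLK : ∀ u ∈ K, L u = f u := by
    intro v hv
    obtain ⟨u, hu, e⟩ := hL1 v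
    have h1 := hL2 v v hv
    have h2 := hf v hv u hu
    rw [hdsymm] at h2
    rw [hd0] at h1
    linarith
  have hUK : ∀ u ∈ K, U u = f u := by
    intro v hv
    obtain ⟨u, hu, e⟩ := hU1 v
    have h1 := hU2 v v hv
    have h2 := hf u hu v hv
    rw [hd0] at h1
    linarith
  have hcross : ∀ x, x ∉ Y → ∀ y ∈ Y, U y - L x ≤ d x y := by
    intro x hx y hy
    obtain ⟨u, hu, e⟩ : ∃ u ∈ K, d x u + d u y = d x y := by
      rcases hs.cover x with h | h | h
      · exact hs.exists_mid hb h hy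
      · exact absurd h hx
      · exact ⟨x, h, by simp [hd0]⟩
    have h1 := hU2 y u hu
    have h2 := hL2 x u hu
    rw [hdsymm u x] at h2
    linarith
  refine ⟨fun v => if v ∈ Y then U v else L v, ⟨?_, ?_, ?_⟩, ?_⟩
  · intro x y
    by_cases hx : x ∈ Y <;> by_cases hy : y ∈ Y <;> simp only [hx, hy, if_true, if_false]
    · exact lipU x y
    · linarith [hLU x, lipL x y]
    · exact hcross x hx y hy
    · exact lipL x y
  · intro v hv
    obtain ⟨u, hu, e⟩ := hL1 v
    refine ⟨u, hu, ?_⟩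
    simp only [hs.left_not_right v hv, if_false]
    rw [e]
    split_ifs
    · rw [hUK u hu]
    · rw [hLK u hu]
  · intro v hv
    obtain ⟨u, hu, e⟩ := hU1 v
    refine ⟨u, hu, ?_⟩
    simp only [hv, if_true]
    rw [e]
    split_ifs
    · rw [hUK u hu]
    · rw [hLK u hu]
  · intro u hu
    simp only
    split_ifs
    · exact hUK u hu
    · exact hLK u hu

theorem Lip1.le_of_le (hdsymm : ∀ x y, d x y = d y x) {K : Set V} {f g : V → ℝ} (hf : Lip1 d f)
    (hg : Lip1 d g) {c : ℝ} (h : ∀ u ∈ K, f u ≤ g u + c) {v : V}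
    (hv : (∃ u ∈ K, f v = f u - d u v) ∨ ∃ u ∈ K, g v = g u + d u v) : f v ≤ g v + c := by
  rcases hv with ⟨u, hu, e⟩ | ⟨u, hu, e⟩
  · have := hg v u
    rw [hdsymm v u] at this
    linarith [h u hu]
  · linarith [h u hu, hf u v]

theorem Extremal.le_of_le (hb : IsGraphBase w m d) {X Y K : Set V} (hs : Separation w X Y K)
    {f g : V → ℝ} (hf : Extremal d X Y K f) (hg : Extremal d X Y K g) {c : ℝ}
    (h : ∀ u ∈ K, f u ≤ g u + c) (v : V) : f v ≤ g v + c := by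
  rcases hs.cover v with hv | hv | hv
  · exact hf.lip.le_of_le hb.2.2.2.2.2.2.2.1.2.2.1 hg.lip h (.inl (hf.lower v hv))
  · exact hf.lip.le_of_le hb.2.2.2.2.2.2.2.1.2.2.1 hg.lip h (.inr (hg.upper v hv))
  · exact h v hv

end Geometry

/-- No proper nonempty subset of `K` is separated from its complement in `K`. -/
def EdgeConnected (w : V → V → ℝ) (K : Set V) : Prop :=
  ∀ N ⊆ K, N.Nonempty → N ≠ K → ∃ x ∈ N, ∃ y ∈ K, y ∉ N ∧ 0 < w x y

section Variation

variable {w : V → V → ℝ} {m : V → ℝ} {d : V → V → ℝ} {X Y K : Set V}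

/-- One step of the strong maximum principle: lowering an extremal function on the subset of `K`
where its Laplacian is minimal shrinks this subset. -/
theorem Extremal.exists_shrink (hb : IsGraphBase w m d) (hk : NonnegCurv w m d)
    (hs : Separation w X Y K) (hc : EdgeConnected w K) {c : ℝ} {f : V → ℝ}
    (hf : Extremal d X Y K f) (hle : ∀ k ∈ K, c ≤ lap w m f k)
    (heq : ∃ k ∈ K, lap w m f k = c) (hlt : ∃ k ∈ K, c < lap w m f k) :
    ∃ g, Extremal d X Y K g ∧ (∀ k ∈ K, c ≤ lap w m g k) ∧ (∃ k ∈ K, c < lap w m g k) ∧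
      {k ∈ K | lap w m g k = c} ⊂ {k ∈ K | lap w m f k = c} := by
  classical
  have hb' := hb
  obtain ⟨-, -, hw, -, hm, hl, -, ⟨hd0, hdpos, hdsymm, htri, -⟩, -⟩ := hb'
  set N := {k ∈ K | lap w m f k = c} with hN
  have hNK : N ⊆ K := fun k hk => hk.1
  obtain ⟨k₁, hk₁, hk₁lt⟩ := hlt
  have hk₁N : k₁ ∉ N := fun h => hk₁lt.ne' h.2
  have hgt : ∀ k ∈ K \ N, c < lap w m f k := fun k hk =>
    (hle k hk.1).lt_of_ne fun h => hk.2 ⟨hk.1, h.symm⟩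
  obtain ⟨x₀, hx₀, y₀, hy₀, hy₀N, hadj⟩ := hc N hNK heq (fun h => hk₁N (h ▸ hk₁))
  have hstrict : ∀ x ∈ N, ∀ y ∈ K \ N, f y - f x < d x y := by
    intro x hx y hy
    refine (hf.lip x y).lt_of_ne fun h => ?_
    have := lap_anti hb hk hf.lip h
    rw [hx.2] at this
    exact absurd this (hgt y hy).not_ge
  have hfinN : N.Finite := hs.finite.subset hNK
  have hfinD : (K \ N).Finite := hs.finite.subset Set.sdiff_subset
  have hev : ∀ᶠ δ : ℝ in nhdsWithin 0 (Set.Ioi 0),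
      (∀ x ∈ N, ∀ y ∈ K \ N, f y - f x + δ < d x y) ∧
        ∀ y ∈ K \ N, c < lap w m f y - δ * deg w m y := by
    refine Filter.Eventually.filter_mono nhdsWithin_le_nhds (Filter.Eventually.and ?_ ?_)
    · refine (Filter.eventually_all_finite hfinN).2 fun x hx =>
        (Filter.eventually_all_finite hfinD).2 fun y hy => ?_
      refine ContinuousAt.eventually_lt (by fun_prop) (by fun_prop) ?_
      simpa using hstrict x hx y hy
    · refine (Filter.eventually_all_finite hfinD).2 fun y hy => ?_
      refine ContinuousAt.eventually_lt (by fun_prop) (by fun_prop) ?_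
      simpa using hgt y hy
  obtain ⟨δ, ⟨h1, h2⟩, hδ⟩ := (hev.and self_mem_nhdsWithin).exists
  replace hδ : 0 < δ := hδ
  obtain ⟨g, hg, hgK⟩ := hs.exists_extremal hb ⟨k₁, hk₁⟩
    (f := fun v => if v ∈ N then f v - δ else f v) (by
      intro x hx y hy
      by_cases hxN : x ∈ N <;> by_cases hyN : y ∈ N <;>
        simp only [hxN, hyN, if_true, if_false]
      · linarith [hf.lip x y]
      · linarith [h1 x hxN y ⟨hy, hyN⟩]
      · linarith [hf.lip x y]
      · exact hf.lip x y)
  have hgN : ∀ k ∈ N, g k = f k - δ := fun k hk => by simp [hgK k (hNK hk), hk]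
  have hgD : ∀ k ∈ K, k ∉ N → g k = f k := fun k hk hkN => by simp [hgK k hk, hkN]
  have hle_f : ∀ v, g v ≤ f v := by
    intro v
    have := hg.le_of_le hb hs hf (c := 0) (fun u hu => by
      by_cases huN : u ∈ N
      · linarith [hgN u huN]
      · linarith [hgD u hu huN]) v
    linarith
  have hf_le : ∀ v, f v ≤ g v + δ := hf.le_of_le hb hs hg (fun u hu => by
    by_cases huN : u ∈ N
    · linarith [hgN u huN]
    · linarith [hgD u hu huN])
  have hlapN : ∀ k ∈ N, c ≤ lap w m g k := by
    intro k hk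
    rw [← hk.2]
    refine lap_le_lap hw hl hm fun y => ?_
    linarith [hgN k hk, hf_le y]
  have hlapD : ∀ k ∈ K, k ∉ N → c < lap w m g k := by
    intro k hk hkN
    refine (h2 k ⟨hk, hkN⟩).trans_le (lap_sub_le hw hl hm δ fun y => ?_)
    linarith [hgD k hk hkN, hf_le y]
  refine ⟨g, hg, fun k hk => ?_, ⟨k₁, hk₁, hlapD k₁ hk₁ hk₁N⟩, ?_⟩
  · by_cases hkN : k ∈ N
    · exact hlapN k hkN
    · exact (hlapD k hk hkN).le
  · refine Set.ssubset_iff_subset_ne.2 ⟨fun k hk => ?_, fun h => ?_⟩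
    · by_contra hkN
      exact (hlapD k hk.1 hkN).ne' hk.2
    · have hx : lap w m g x₀ = c := (h.symm ▸ hx₀ : x₀ ∈ {k ∈ K | lap w m g k = c}).2
      have : lap w m f x₀ < lap w m g x₀ := by
        refine lap_lt_lap hw hl hm (fun y => ?_) hadj ?_
        · linarith [hgN x₀ hx₀, hf_le y]
        · linarith [hgN x₀ hx₀, hgD y₀ hy₀ hy₀N]
      rw [hx, hx₀.2] at this
      exact lt_irrefl _ this

/-- An extremal function whose Laplacian on `K` is bounded below by `c` and is not constantly
`c` can be deformed into one whose Laplacian on `K` is larger than `c`. -/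
theorem Extremal.exists_lt_lap (hb : IsGraphBase w m d) (hk : NonnegCurv w m d)
    (hs : Separation w X Y K) (hc : EdgeConnected w K) {c : ℝ} {f : V → ℝ}
    (hf : Extremal d X Y K f) (hle : ∀ k ∈ K, c ≤ lap w m f k)
    (hlt : ∃ k ∈ K, c < lap w m f k) :
    ∃ g, Extremal d X Y K g ∧ ∀ k ∈ K, c < lap w m g k := by
  induction hn : {k ∈ K | lap w m f k = c}.ncard using Nat.strong_induction_on
    generalizing f with
  | _ n ih =>
    by_cases heq : ∃ k ∈ K, lap w m f k = c
    · obtain ⟨g, hg, hgle, hglt, hss⟩ := hf.exists_shrink hb hk hs hc hle heq hlt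
      exact ih _ (hn ▸ Set.ncard_lt_ncard hss (hs.finite.subset fun k hk => hk.1))
        hg hgle hglt rfl
    · push Not at heq
      exact ⟨f, hf, fun k hk => (hle k hk).lt_of_ne (heq k hk).symm⟩

theorem Extremal.lap_le_of_mem_right (hb : IsGraphBase w m d) (hk : NonnegCurv w m d) {c : ℝ}
    {f : V → ℝ} (hf : Extremal d X Y K f) (hc : ∀ k ∈ K, lap w m f k ≤ c) {v : V}
    (hv : v ∈ Y) : lap w m f v ≤ c := by
  obtain ⟨u, hu, e⟩ := hf.upper v hv
  exact (lap_anti hb hk hf.lip (by linarith)).trans (hc u hu)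

theorem Extremal.le_lap_of_mem_left (hb : IsGraphBase w m d) (hk : NonnegCurv w m d) {c : ℝ}
    {f : V → ℝ} (hf : Extremal d X Y K f) (hc : ∀ k ∈ K, c ≤ lap w m f k) {v : V}
    (hv : v ∈ X) : c ≤ lap w m f v := by
  obtain ⟨u, hu, e⟩ := hf.lower v hv
  refine (hc u hu).trans (lap_anti hb hk hf.lip ?_)
  rw [hb.2.2.2.2.2.2.2.1.2.2.1 v u]
  linarith

end Variation

section Flux

variable {w : V → V → ℝ} {m : V → ℝ} {d : V → V → ℝ} {X Y K : Set V}

/-- The flux inequality: if `W` is a superlevel set of `f` in `X` containing every vertex of `X`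
adjacent to `K`, then the integral of `Δf` over `W` is bounded by the flux through `K`. -/
theorem sum_mul_lap_le (hb : IsGraphBase w m d) (hs : Separation w X Y K) (f : V → ℝ)
    (K' N W : Finset V) (hK' : ∀ v, v ∈ K' ↔ v ∈ K)
    (hN : ∀ x, x ∈ N ↔ x ∈ X ∧ ∃ k ∈ K, 0 < w x k) (hNW : N ⊆ W) {t : ℝ}
    (hW : ∀ x, x ∈ W ↔ x ∈ X ∧ t ≤ f x) :
    ∑ x ∈ W, m x * lap w m f x ≤ ∑ x ∈ N, ∑ k ∈ K', w x k * (f k - f x) ∧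
      ((∃ x ∈ W, ∃ y ∈ X, y ∉ W ∧ 0 < w x y) →
        ∑ x ∈ W, m x * lap w m f x < ∑ x ∈ N, ∑ k ∈ K', w x k * (f k - f x)) := by
  classical
  obtain ⟨-, hwsymm, hw, -, hm, hl, -, -, -⟩ := hb
  set T : Finset V := W.biUnion fun x => (hl x).toFinset with hT
  have hTm : ∀ x ∈ W, ∀ y, 0 < w x y → y ∈ T := fun x hx y hy =>
    Finset.mem_biUnion.2 ⟨x, hx, by simpa using hy⟩
  set R : Finset V := (T \ W) \ K' with hR
  have hdisj : Disjoint W K' := Finset.disjoint_left.2 fun x hx hxK =>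
    hs.left_not_mid x ((hW x).1 hx).1 ((hK' x).1 hxK)
  have hsub : ∀ x ∈ W, ∀ y, 0 < w x y → y ∈ W ∪ (K' ∪ R) := by
    intro x hx y hy
    have := hTm x hx y hy
    simp only [hR, Finset.mem_union, Finset.mem_sdiff]
    tauto
  have hdisj1 : Disjoint W (K' ∪ R) := by
    rw [Finset.disjoint_union_right]
    exact ⟨hdisj, Finset.disjoint_left.2 fun x hx hxR => by simp [hR, hx] at hxR⟩
  have hdisj2 : Disjoint K' R := Finset.disjoint_left.2 fun x hx hxR => by simp [hR, hx] at hxR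
  have hlap : ∀ x ∈ W, m x * lap w m f x = ∑ y ∈ W, w x y * (f y - f x) +
      (∑ k ∈ K', w x k * (f k - f x) + ∑ y ∈ R, w x y * (f y - f x)) := by
    intro x hx
    rw [lap_eq_sum hw _ (hsub x hx), mul_inv_cancel_left₀ (hm x).ne',
      Finset.sum_union hdisj1, Finset.sum_union hdisj2]
  have hanti : ∑ x ∈ W, ∑ y ∈ W, w x y * (f y - f x) = 0 := by
    have : ∑ x ∈ W, ∑ y ∈ W, w x y * (f y - f x) =
        -∑ x ∈ W, ∑ y ∈ W, w x y * (f y - f x) := by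
      conv_lhs => rw [Finset.sum_comm]
      rw [← Finset.sum_neg_distrib]
      refine Finset.sum_congr rfl fun x _ => ?_
      rw [← Finset.sum_neg_distrib]
      refine Finset.sum_congr rfl fun y _ => ?_
      rw [hwsymm y x]
      ring
    linarith
  have hKN : ∑ x ∈ W, ∑ k ∈ K', w x k * (f k - f x) =
      ∑ x ∈ N, ∑ k ∈ K', w x k * (f k - f x) := by
    symm
    refine Finset.sum_subset hNW fun x hxW hxN => Finset.sum_eq_zero fun k hk => ?_
    have : w x k = 0 := by
      refine le_antisymm (not_lt.1 fun h => hxN ((hN x).2 ⟨((hW x).1 hxW).1, k, ?_, h⟩)) (hw x k)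
      exact (hK' k).1 hk
    rw [this, zero_mul]
  have hneg : ∀ x ∈ W, ∀ y ∈ R, 0 < w x y → f y - f x < 0 := by
    intro x hx y hy hxy
    simp only [hR, Finset.mem_sdiff, hK'] at hy
    have hx' := (hW x).1 hx
    have hyX : y ∈ X := by
      rcases hs.cover y with h | h | h
      · exact h
      · exact absurd (hs.noEdge x hx'.1 y h) hxy.ne'
      · exact absurd h hy.2
    have : f y < t := not_le.1 fun h => hy.1.2 ((hW y).2 ⟨hyX, h⟩)
    linarith
  have hterm : ∀ x ∈ W, ∀ y ∈ R, w x y * (f y - f x) ≤ 0 := by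
    intro x hx y hy
    rcases (hw x y).lt_or_eq with h | h
    · exact mul_nonpos_of_nonneg_of_nonpos (hw x y) (hneg x hx y hy h).le
    · simp [← h]
  rw [Finset.sum_congr rfl hlap, Finset.sum_add_distrib, Finset.sum_add_distrib, hanti, hKN]
  have hbot : ∀ x ∈ W, ∑ y ∈ R, w x y * (f y - f x) ≤ 0 := fun x hx =>
    Finset.sum_nonpos (hterm x hx)
  refine ⟨by linarith [Finset.sum_nonpos hbot], ?_⟩
  rintro ⟨x, hx, y, hyX, hyW, hxy⟩
  have hyR : y ∈ R := by
    simp only [hR, Finset.mem_sdiff, hK']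
    exact ⟨⟨hTm x hx y hxy, hyW⟩, hs.left_not_mid y hyX⟩
  have : ∑ x ∈ W, ∑ y ∈ R, w x y * (f y - f x) < 0 :=
    Finset.sum_neg' hbot ⟨x, hx, Finset.sum_neg' (hterm x hx)
      ⟨y, hyR, mul_neg_of_pos_of_neg hxy (hneg x hx y hyR hxy)⟩⟩
  linarith

theorem Separation.finite_boundary (hb : IsGraphBase w m d) (hs : Separation w X Y K) :
    {x | x ∈ X ∧ ∃ k ∈ K, 0 < w x k}.Finite := by
  obtain ⟨-, hwsymm, -, -, -, hl, -⟩ := hb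
  refine (hs.finite.biUnion fun k _ => hl k).subset ?_
  rintro x ⟨-, k, hk, h⟩
  exact Set.mem_biUnion hk (by rwa [hwsymm] at h)

theorem Separation.finite_superlevel (hb : IsGraphBase w m d) (hs : Separation w X Y K)
    {f : V → ℝ} (hf : ∀ v ∈ X, ∃ u ∈ K, f v = f u - d u v) (t : ℝ) :
    {x | x ∈ X ∧ t ≤ f x}.Finite := by
  refine (hs.finite.biUnion fun k _ => hb.2.2.2.2.2.2.2.2 k (f k - t)).subset ?_
  rintro x ⟨hx, ht⟩
  obtain ⟨u, hu, e⟩ := hf x hx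
  refine Set.mem_biUnion hu ?_
  have : d u x ≤ f u - t := by linarith
  exact this

/-- If `X` has infinite volume, the Laplacian of an extremal function is not bounded below by a
positive constant on `X`. -/
theorem Extremal.not_pos_le_lap (hb : IsGraphBase w m d) (hs : Separation w X Y K)
    (hX : InfVolume m X) {f : V → ℝ} (hf : Extremal d X Y K f) {c : ℝ} (hc : 0 < c) :
    ¬ ∀ x ∈ X, c ≤ lap w m f x := by
  classical
  intro hlap
  have hm := hb.2.2.2.2.1
  set N := (hs.finite_boundary hb).toFinset with hN
  set K' := hs.finite.toFinset with hK'
  obtain ⟨F, hFX, hF⟩ := hX ((∑ x ∈ N, ∑ k ∈ K', w x k * (f k - f x)) / c)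
  obtain ⟨t, ht⟩ := ((F ∪ N).finite_toSet.image f).bddBelow
  replace ht : ∀ x ∈ F ∪ N, t ≤ f x := fun x hx => ht ⟨x, hx, rfl⟩
  set W := (hs.finite_superlevel hb hf.lower t).toFinset with hW
  have hNX : ∀ x ∈ N, x ∈ X := fun x hx => by
    simp only [hN, Set.Finite.mem_toFinset] at hx
    exact hx.1
  have h1 := (sum_mul_lap_le hb hs f K' N W (by simp [hK']) (by simp [hN])
    (fun x hx => by
      simp only [hW, Set.Finite.mem_toFinset]
      exact ⟨hNX x hx, ht x (Finset.mem_union_right _ hx)⟩) (t := t) (by simp [hW])).1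
  have hFW : F ⊆ W := fun x hx => by
    simp only [hW, Set.Finite.mem_toFinset]
    exact ⟨hFX hx, ht x (Finset.mem_union_left _ hx)⟩
  have h2 : ∑ x ∈ F, m x ≤ ∑ x ∈ W, m x :=
    Finset.sum_le_sum_of_subset_of_nonneg hFW fun x _ _ => (hm x).le
  have h3 : ∑ x ∈ W, m x * c ≤ ∑ x ∈ W, m x * lap w m f x := by
    refine Finset.sum_le_sum fun x hx => mul_le_mul_of_nonneg_left (hlap x ?_) (hm x).le
    simp only [hW, Set.Finite.mem_toFinset] at hx
    exact hx.1
  rw [← Finset.sum_mul] at h3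
  rw [div_lt_iff₀ hc] at hF
  nlinarith

/-- A path from `y ∈ A` to `k ∉ A` crosses the boundary of `A`. -/
theorem GraphConnected.exists_boundary_edge (hc : GraphConnected w) {A : Set V} {y k : V}
    (hy : y ∈ A) (hk : k ∉ A) : ∃ v ∈ A, ∃ v', v' ∉ A ∧ 0 < w v v' := by
  by_contra! hcon
  have : ∀ z, Relation.ReflTransGen (fun a b => 0 < w a b) y z → z ∈ A := by
    intro z hz
    induction hz with
    | refl => exact hy
    | tail _ h ih =>
      by_contra hA
      exact absurd h (hcon _ ih _ hA).not_gt
  exact hk (this k (hc y k))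

/-- The flux of a subharmonic, downwards extremal function from `K` into an infinite part is
positive. -/
theorem Separation.flux_pos (hb : IsGraphBase w m d) (hs : Separation w X Y K)
    (hK : K.Nonempty) (hX : X.Infinite) {f : V → ℝ}
    (hf : ∀ v ∈ X, ∃ u ∈ K, f v = f u - d u v) (hlap : ∀ x ∈ X, 0 ≤ lap w m f x)
    (K' N : Finset V) (hK' : ∀ v, v ∈ K' ↔ v ∈ K)
    (hN : ∀ x, x ∈ N ↔ x ∈ X ∧ ∃ k ∈ K, 0 < w x k) :
    0 < ∑ x ∈ N, ∑ k ∈ K', w x k * (f k - f x) := by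
  classical
  have hm := hb.2.2.2.2.1
  obtain ⟨t, ht⟩ := (N.finite_toSet.image f).bddBelow
  replace ht : ∀ x ∈ N, t ≤ f x := fun x hx => ht ⟨x, hx, rfl⟩
  set W := (hs.finite_superlevel hb hf t).toFinset with hW
  have hWm : ∀ x, x ∈ W ↔ x ∈ X ∧ t ≤ f x := by simp [hW]
  have hNW : N ⊆ W := fun x hx => (hWm x).2 ⟨((hN x).1 hx).1, ht x hx⟩
  refine (Finset.sum_nonneg fun x hx =>
    mul_nonneg (hm x).le (hlap x ((hWm x).1 hx).1)).trans_lt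
      ((sum_mul_lap_le hb hs f K' N W hK' hN hNW hWm).2 ?_)
  obtain ⟨y, hyX, hyW⟩ := (hX.sdiff W.finite_toSet).nonempty
  obtain ⟨k, hk⟩ := hK
  obtain ⟨v, ⟨hvX, hvW⟩, v', hv', hadj⟩ := hb.2.2.2.2.2.2.1.exists_boundary_edge
    (A := X \ (W : Set V)) (k := k) ⟨hyX, hyW⟩ fun h => hs.left_not_mid k h.1 hk
  rcases hs.cover v' with h | h | h
  · have hv'W : v' ∈ W := by
      by_contra hcon
      exact hv' ⟨h, hcon⟩
    exact ⟨v', hv'W, v, hvX, hvW, by rwa [hb.2.1]⟩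
  · exact absurd (hs.noEdge v hvX v' h) hadj.ne'
  · exact absurd (hNW ((hN v).2 ⟨hvX, v', h, hadj⟩)) hvW

end Flux

section Existence

variable {w : V → V → ℝ} {m : V → ℝ} {d : V → V → ℝ} {X Y K : Set V}

theorem Extremal.sub_const {f : V → ℝ} (hf : Extremal d X Y K f) (c : ℝ) :
    Extremal d X Y K (fun v => f v - c) where
  lip x y := by linarith [hf.lip x y]
  lower v hv := by
    obtain ⟨u, hu, e⟩ := hf.lower v hv
    exact ⟨u, hu, by rw [e]; ring⟩
  upper v hv := by
    obtain ⟨u, hu, e⟩ := hf.upper v hv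
    exact ⟨u, hu, by rw [e]; ring⟩

theorem isCompact_extremal (hb : IsGraphBase w m d) (hs : Separation w X Y K) (o : V) :
    IsCompact {f : V → ℝ | Extremal d X Y K f ∧ f o = 0} := by
  have hdsymm := hb.2.2.2.2.2.2.2.1.2.2.1
  refine (isCompact_univ_pi fun v => isCompact_Icc (a := -d o v) (b := d o v)).of_isClosed_subset
    ?_ ?_
  · have : {f : V → ℝ | Extremal d X Y K f ∧ f o = 0} =
        ((⋂ x, ⋂ y, {f : V → ℝ | f y - f x ≤ d x y}) ∩
          ((⋂ v ∈ X, ⋃ u ∈ K, {f : V → ℝ | f v = f u - d u v}) ∩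
          (⋂ v ∈ Y, ⋃ u ∈ K, {f : V → ℝ | f v = f u + d u v}))) ∩ {f : V → ℝ | f o = 0} := by
      ext f
      simp only [Set.mem_inter_iff, Set.mem_iInter, Set.mem_iUnion, exists_prop]
      constructor
      · rintro ⟨⟨h1, h2, h3⟩, h4⟩
        exact ⟨⟨h1, h2, h3⟩, h4⟩
      · rintro ⟨⟨h1, h2, h3⟩, h4⟩
        exact ⟨⟨h1, h2, h3⟩, h4⟩
    rw [this]
    refine IsClosed.inter (IsClosed.inter ?_ (IsClosed.inter ?_ ?_)) ?_
    · exact isClosed_iInter fun x => isClosed_iInter fun y =>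
        isClosed_le (by fun_prop) (by fun_prop)
    · exact isClosed_iInter fun v => isClosed_iInter fun _ => hs.finite.isClosed_biUnion
        fun u _ => isClosed_eq (by fun_prop) (by fun_prop)
    · exact isClosed_iInter fun v => isClosed_iInter fun _ => hs.finite.isClosed_biUnion
        fun u _ => isClosed_eq (by fun_prop) (by fun_prop)
    · exact isClosed_eq (by fun_prop) (by fun_prop)
  · rintro f ⟨hf, ho⟩ v -
    have h1 := hf.lip o v
    have h2 := hf.lip v o
    rw [hdsymm v o] at h2
    constructor <;> linarith

/-- If `X` has infinite volume, an extremal function subharmonic on `K` is harmonic on `K`. -/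
theorem Extremal.lap_eq_zero (hb : IsGraphBase w m d) (hk : NonnegCurv w m d)
    (hs : Separation w X Y K) (hc : EdgeConnected w K) (hX : InfVolume m X) {f : V → ℝ}
    (hf : Extremal d X Y K f) (hle : ∀ k ∈ K, 0 ≤ lap w m f k) {k : V} (hkK : k ∈ K) :
    lap w m f k = 0 := by
  by_contra hne
  obtain ⟨g, hg, hpos⟩ := hf.exists_lt_lap hb hk hs hc hle
    ⟨k, hkK, (hle k hkK).lt_of_ne' hne⟩
  obtain ⟨k₀, hk₀, hmin⟩ := Set.exists_min_image K (lap w m g) hs.finite ⟨k, hkK⟩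
  exact hg.not_pos_le_lap hb hs hX (hpos k₀ hk₀) fun x hx =>
    hg.le_lap_of_mem_left hb hk hmin hx

/-- If `Y` has infinite volume, there is an extremal function subharmonic on `K`. -/
theorem Separation.exists_lap_nonneg (hb : IsGraphBase w m d) (hk : NonnegCurv w m d)
    (hs : Separation w X Y K) (hc : EdgeConnected w K) (hK : K.Nonempty)
    (hY : InfVolume m Y) : ∃ f, Extremal d X Y K f ∧ ∀ k ∈ K, 0 ≤ lap w m f k := by
  classical
  have hb' := hb
  obtain ⟨-, hwsymm, hw, -, hm, hl, -, ⟨hd0, hdpos, hdsymm, -⟩, -⟩ := hb'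
  obtain ⟨o, ho⟩ := hK
  have hne : hs.finite.toFinset.Nonempty := ⟨o, by simpa using ho⟩
  have hcont : Continuous fun f : V → ℝ =>
      hs.finite.toFinset.inf' hne fun k => lap w m f k :=
    Continuous.finset_inf'_apply hne fun k _ => continuous_lap hw hl k
  obtain ⟨f₀, hf₀, -⟩ := hs.exists_extremal hb ⟨o, ho⟩ (f := fun _ => 0) (by
    intro x _ y _
    rcases eq_or_ne x y with rfl | h
    · simp [hd0]
    · simpa using (hdpos x y h).le)
  obtain ⟨f, ⟨hf, -⟩, hmax⟩ := (isCompact_extremal hb hs o).exists_isMaxOn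
    ⟨_, hf₀.sub_const (f₀ o), sub_self _⟩ hcont.continuousOn
  set c := hs.finite.toFinset.inf' hne fun k => lap w m f k with hcdef
  have hle : ∀ k ∈ K, c ≤ lap w m f k := fun k hk =>
    Finset.inf'_le _ (by simpa using hk)
  have heq : ∀ k ∈ K, lap w m f k ≤ c := by
    by_contra! hcon
    obtain ⟨g, hg, hpos⟩ := hf.exists_lt_lap hb hk hs hc hle hcon
    have h1 : (hs.finite.toFinset.inf' hne fun k => lap w m (fun v => g v - g o) k) ≤ c :=
      hmax (show _ ∧ _ from ⟨hg.sub_const (g o), sub_self _⟩)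
    refine absurd h1 (not_le.2 ((Finset.lt_inf'_iff hne).2 fun k hk => ?_))
    exact (hpos k (by simpa using hk)).trans_le (lap_le_lap hw hl hm fun y => by linarith)
  refine ⟨f, hf, fun k hkK => le_trans ?_ (hle k hkK)⟩
  by_contra! hneg
  refine (hf.neg hdsymm).not_pos_le_lap hb (hs.symm hwsymm) hY (neg_pos.2 hneg) fun y hy => ?_
  rw [lap_neg]
  exact neg_le_neg (hf.lap_le_of_mem_right hb hk heq hy)

/-- The complement of a finite connected set does not contain two parts of infinite volume and a
third infinite part. -/
theorem false_of_three_parts (hb : IsGraphBase w m d) (hk : NonnegCurv w m d) {A B C : Set V}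
    (hA : Separation w A (B ∪ C) K) (hB : Separation w (A ∪ C) B K)
    (hC : Separation w C (A ∪ B) K) (hc : EdgeConnected w K) (hK : K.Nonempty)
    (hAm : InfVolume m A) (hBm : InfVolume m B) (hCi : C.Infinite) : False := by
  classical
  have hb' := hb
  obtain ⟨-, hwsymm, hw, -, hm, hl, -, ⟨-, -, hdsymm, -⟩, -⟩ := hb'
  obtain ⟨f, hf, hf0⟩ := hB.exists_lap_nonneg hb hk hc hK hBm
  obtain ⟨g, hg, hgK⟩ := hA.exists_extremal hb hK (f := f) fun x _ y _ => hf.lip x y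
  have hfg : ∀ v, f v ≤ g v := by
    intro v
    have hK0 : ∀ u ∈ K, f u ≤ g u + 0 := fun u hu => by rw [hgK u hu, add_zero]
    rw [← add_zero (g v)]
    rcases hC.cover v with hv | (hv | hv) | hv
    · exact hf.lip.le_of_le hdsymm hg.lip hK0 (.inl (hf.lower v (.inr hv)))
    · exact hf.lip.le_of_le hdsymm hg.lip hK0 (.inl (hf.lower v (.inl hv)))
    · exact hf.lip.le_of_le hdsymm hg.lip hK0 (.inr (hg.upper v (.inl hv)))
    · exact hK0 v hv
  have hdiff : ∀ k ∈ K, ∀ y, f y - f k ≤ g y - g k := fun k hk y => by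
    rw [hgK k hk]
    linarith [hfg y]
  have hg0 : ∀ k ∈ K, lap w m g k = 0 := fun k hkK =>
    hg.lap_eq_zero hb hk hA hc hAm
      (fun k hkK => (hf0 k hkK).trans (lap_le_lap hw hl hm (hdiff k hkK))) hkK
  have hadj : ∀ k ∈ K, ∀ y, 0 < w k y → f y = g y := by
    intro k hkK y hy
    by_contra hne
    have := lap_lt_lap hw hl hm (hdiff k hkK) hy (by
      rw [hgK k hkK]
      linarith [(hfg y).lt_of_ne hne])
    rw [hg0 k hkK] at this
    exact absurd (hf0 k hkK) this.not_ge
  set K' := hC.finite.toFinset with hK'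
  set N := (hC.finite_boundary hb).toFinset with hN
  have h1 := hC.flux_pos hb hK hCi (fun v hv => hf.lower v (.inr hv))
    (fun x hx => hf.le_lap_of_mem_left hb hk hf0 (.inr hx)) K' N (by simp [hK']) (by simp [hN])
  have h2 := hC.flux_pos hb hK hCi (fun v hv => (hg.neg hdsymm).lower v (.inr hv))
    (fun x hx => by
      rw [lap_neg]
      linarith [hg.lap_le_of_mem_right hb hk (fun k hk => (hg0 k hk).le)
        (Or.inr hx : x ∈ B ∪ C)]) K' N (by simp [hK']) (by simp [hN])
  have h3 : ∑ x ∈ N, ∑ k ∈ K', w x k * (-g k - -g x) =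
      -∑ x ∈ N, ∑ k ∈ K', w x k * (f k - f x) := by
    rw [← Finset.sum_neg_distrib]
    refine Finset.sum_congr rfl fun x hx => ?_
    rw [← Finset.sum_neg_distrib]
    refine Finset.sum_congr rfl fun k hk => ?_
    replace hk : k ∈ K := by simpa [hK'] using hk
    rcases (hw x k).lt_or_eq with h | h
    · rw [hgK k hk, hadj k hk x (by rwa [hwsymm])]
      ring
    · simp [← h]
  linarith

end Existence

section Volume

variable {m : V → ℝ} {A : Set V}

theorem InfVolume.infinite (hm : ∀ x, 0 < m x) (h : InfVolume m A) : A.Infinite := by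
  intro hfin
  obtain ⟨F, hFA, hF⟩ := h (∑ x ∈ hfin.toFinset, m x)
  refine absurd hF (not_lt.2 (Finset.sum_le_sum_of_subset_of_nonneg (fun x hx => ?_)
    fun x _ _ => (hm x).le))
  simpa using hFA hx

theorem InfVolume.sdiff (hm : ∀ x, 0 < m x) (h : InfVolume m A) {K : Set V} (hK : K.Finite) :
    InfVolume m (A \ K) := by
  classical
  intro c
  obtain ⟨F, hFA, hF⟩ := h (c + ∑ x ∈ hK.toFinset, m x)
  refine ⟨F \ hK.toFinset, fun x hx => ?_, ?_⟩
  · simp only [Finset.coe_sdiff, Set.Finite.coe_toFinset] at hx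
    exact ⟨hFA hx.1, hx.2⟩
  · have h1 : ∑ x ∈ F, m x ≤ ∑ x ∈ (F \ hK.toFinset) ∪ hK.toFinset, m x :=
      Finset.sum_le_sum_of_subset_of_nonneg (by simp) fun x _ _ => (hm x).le
    rw [Finset.sum_union Finset.sdiff_disjoint] at h1
    linarith

theorem InfVolume.exists_fiber (h : InfVolume m A) {ι : Type*} [Fintype ι] (L : V → ι) :
    ∃ i, InfVolume m (A ∩ L ⁻¹' {i}) := by
  classical
  by_contra! hcon
  simp only [InfVolume, not_forall, not_exists, not_and, not_lt] at hcon
  choose c hc using hcon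
  obtain ⟨F, hFA, hF⟩ := h (∑ i, c i)
  rw [← Finset.sum_fiberwise F L] at hF
  refine absurd hF (not_lt.2 (Finset.sum_le_sum fun i _ => hc i _ fun x hx => ?_))
  rw [Finset.mem_coe, Finset.mem_filter] at hx
  exact ⟨hFA hx.1, hx.2⟩

end Volume

section Ends

variable {w : V → V → ℝ} {m : V → ℝ} {d : V → V → ℝ} {X Y K : Set V}

theorem reachIn.mem {A S : Set V} (hS : ∀ a ∈ S, ∀ b ∈ A, 0 < w a b → b ∈ S) {x y : V}
    (h : reachIn w A x y) (hx : x ∈ S) : y ∈ S := by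
  induction h with
  | refl => exact hx
  | tail _ h ih => exact hS _ ih _ h.2.1 h.2.2

theorem reachIn.symm (hw : ∀ x y, w x y = w y x) {A : Set V} {x y : V} (h : reachIn w A x y) :
    reachIn w A y x := by
  induction h with
  | refl => exact .refl
  | tail _ h ih => exact .head ⟨h.2.1, h.1, by rw [hw]; exact h.2.2⟩ ih

theorem edgeConnected_ball (hb : IsGraphBase w m d) (o : V) (R : ℝ) :
    EdgeConnected w {v | d o v ≤ R} := by
  obtain ⟨hd0, hdpos, hdsymm, -⟩ := hb.2.2.2.2.2.2.2.1
  have key : ∀ N ⊆ {v | d o v ≤ R}, N.Nonempty → o ∉ N →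
      ∃ x ∈ N, ∃ y ∈ {v | d o v ≤ R}, y ∉ N ∧ 0 < w x y := by
    intro N hN hne ho
    obtain ⟨x, hx, hmin⟩ := Set.exists_min_image N (fun v => d v o)
      ((hb.2.2.2.2.2.2.2.2 o R).subset hN) hne
    obtain ⟨z, hz, hz0, hadd⟩ := exists_adj_dist_add hb (x := x) (y := o)
      (by rintro rfl; exact ho hx)
    refine ⟨x, hx, z, ?_, fun hzN => ?_, hz⟩
    · have h1 : d o x ≤ R := hN hx
      have h2 : d o z ≤ R := by
        rw [hdsymm] at h1 ⊢
        linarith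
      exact h2
    · linarith [hmin z hzN]
  intro N hN hne hneq
  by_cases ho : o ∈ N
  · obtain ⟨x, hx, y, hy, hyN, hxy⟩ := key ({v | d o v ≤ R} \ N) Set.sdiff_subset
      (Set.nonempty_of_ssubset (hN.ssubset_of_ne hneq)) fun h => h.2 ho
    refine ⟨y, ?_, x, hx.1, hx.2, by rwa [hb.2.1]⟩
    by_contra hcon
    exact hyN ⟨hy, hcon⟩
  · exact key N hN hne ho

/-- Every finite set is contained in a finite, nonempty, edge connected set. -/
theorem exists_edgeConnected_superset (hb : IsGraphBase w m d) (o : V) (hK : K.Finite) :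
    ∃ K' : Set V, K ⊆ K' ∧ K'.Finite ∧ K'.Nonempty ∧ EdgeConnected w K' := by
  obtain ⟨R, hR⟩ := (hK.image (d o)).bddAbove
  refine ⟨{v | d o v ≤ max R 0}, fun v hv => (hR ⟨v, hv, rfl⟩).trans (le_max_left _ _),
    hb.2.2.2.2.2.2.2.2 o _, ⟨o, ?_⟩, edgeConnected_ball hb o _⟩
  have : d o o ≤ max R 0 := by
    rw [hb.2.2.2.2.2.2.2.1.1]
    exact le_max_right _ _
  exact this

theorem SalamiPartition.separation (h : SalamiPartition w m X Y K) : Separation w X Y K := by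
  obtain ⟨h1, h2, h3, h4, h5, h6, -, -⟩ := h
  refine ⟨fun v => ?_, fun v hv hv' => Set.disjoint_left.1 h2 hv hv',
    fun v hv hv' => Set.disjoint_left.1 h3 hv hv',
    fun v hv hv' => Set.disjoint_left.1 h4 hv hv', h5, h6⟩
  have : v ∈ X ∪ Y ∪ K := h1 ▸ Set.mem_univ v
  rcases this with (h | h) | h <;> simp [h]

/-- An infinite side of a separation contains an infinite connected component. -/
theorem Separation.exists_infinite_component (hb : IsGraphBase w m d)
    (hs : Separation w X Y K) (hX : X.Infinite) (hY : Y.Nonempty) :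
    ∃ x ∈ X, {y | reachIn w Kᶜ x y}.Infinite := by
  by_contra! hcon
  refine hX (((hs.finite_boundary hb).biUnion (t := fun x => {y | reachIn w Kᶜ x y})
    fun x hx => hcon x hx.1).subset fun v hv => ?_)
  obtain ⟨y, hy⟩ := hY
  have hXX : ∀ a ∈ X, ∀ b ∈ Kᶜ, 0 < w a b → b ∈ X := by
    intro a ha b hbK hab
    rcases hs.cover b with h | h | h
    · exact h
    · exact absurd (hs.noEdge a ha b h) hab.ne'
    · exact absurd h hbK
  obtain ⟨x, hx, k, hk, hxk⟩ := hb.2.2.2.2.2.2.1.exists_boundary_edge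
    (A := {z | reachIn w Kᶜ v z}) (y := v) (k := y) Relation.ReflTransGen.refl
    fun h => hs.left_not_right y (reachIn.mem hXX h hv) hy
  have hxX : x ∈ X := reachIn.mem hXX hx hv
  have hkK : k ∈ K := by
    by_contra hcon
    exact hk (Relation.ReflTransGen.tail hx ⟨hs.left_not_mid x hxX, hcon, hxk⟩)
  exact Set.mem_biUnion (show x ∈ {x | x ∈ X ∧ ∃ k ∈ K, 0 < w x k} from ⟨hxX, k, hkK, hxk⟩)
    (reachIn.symm hb.2.1 hx)

theorem SalamiPartition.atLeastEnds_two (hb : IsGraphBase w m d)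
    (h : SalamiPartition w m X Y K) : atLeastEnds w 2 := by
  have hs := h.separation
  have hXi := h.2.2.2.2.2.2.1.infinite hb.2.2.2.2.1
  have hYi := h.2.2.2.2.2.2.2.infinite hb.2.2.2.2.1
  obtain ⟨x, hx, hxi⟩ := hs.exists_infinite_component hb hXi hYi.nonempty
  obtain ⟨y, hy, hyi⟩ := (hs.symm hb.2.1).exists_infinite_component hb hYi hXi.nonempty
  have hxy : ¬ reachIn w Kᶜ x y := by
    intro hr
    refine hs.left_not_right y (reachIn.mem (S := X) (fun a ha b hbK hab => ?_) hr hx) hy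
    rcases hs.cover b with h | h | h
    · exact h
    · exact absurd (hs.noEdge a ha b h) hab.ne'
    · exact absurd h hbK
  refine ⟨K, hs.finite, ![x, y], ?_, ?_, ?_⟩
  · simpa [Fin.forall_fin_two] using ⟨hs.left_not_mid x hx, hs.right_not_mid y hy⟩
  · simpa [Fin.forall_fin_two] using ⟨hxi, hyi⟩
  · simpa [Fin.forall_fin_two] using ⟨hxy, fun hr => hxy (reachIn.symm hb.2.1 hr)⟩

theorem SalamiPartition.not_atLeastEnds_three (hb : IsGraphBase w m d)
    (hk : NonnegCurv w m d) (h : SalamiPartition w m X Y K) : ¬ atLeastEnds w 3 := by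
  classical
  rintro ⟨K₁, hK₁, x, hxK₁, hinf, hdis⟩
  have hs := h.separation
  have hm := hb.2.2.2.2.1
  have hwsymm := hb.2.1
  obtain ⟨K', hsub, hfin, hne, hconn⟩ :=
    exists_edgeConnected_superset hb (x 0) (hs.finite.union hK₁)
  have hKK' : K ⊆ K' := Set.subset_union_left.trans hsub
  have hK₁K' : K₁ ⊆ K' := Set.subset_union_right.trans hsub
  let L : V → Fin 3 := fun v =>
    if reachIn w K₁ᶜ (x 0) v then 0 else if reachIn w K₁ᶜ (x 1) v then 1 else 2
  have hLx : ∀ i v, reachIn w K₁ᶜ (x i) v → L v = i := by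
    have hne : ∀ i j v, i ≠ j → reachIn w K₁ᶜ (x i) v → ¬ reachIn w K₁ᶜ (x j) v :=
      fun i j v hij h1 h2 => hdis i j hij (h1.trans (reachIn.symm hwsymm h2))
    intro i v hv
    fin_cases i
    · exact if_pos hv
    · have h0 := hne 1 0 v (by decide) hv
      exact (if_neg h0).trans (if_pos hv)
    · have h0 := hne 2 0 v (by decide) hv
      have h1 := hne 2 1 v (by decide) hv
      exact (if_neg h0).trans (if_neg h1)
  have hLadj : ∀ u ∉ K', ∀ v ∉ K', 0 < w u v → L u = L v := by
    intro u hu v hv huv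
    have hstep : ∀ i, reachIn w K₁ᶜ (x i) u ↔ reachIn w K₁ᶜ (x i) v := fun i =>
      ⟨fun h => h.tail ⟨fun h => hu (hK₁K' h), fun h => hv (hK₁K' h), huv⟩,
        fun h => h.tail ⟨fun h => hv (hK₁K' h), fun h => hu (hK₁K' h), by rwa [hwsymm]⟩⟩
    simp only [L, hstep]
  obtain ⟨i, hi⟩ := (h.2.2.2.2.2.2.1.sdiff hm hfin).exists_fiber L
  obtain ⟨j, hj⟩ := (h.2.2.2.2.2.2.2.sdiff hm hfin).exists_fiber L
  obtain ⟨l, hli, hlj⟩ : ∃ l : Fin 3, l ≠ i ∧ l ≠ j := by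
    clear hi hj
    revert i j
    decide
  set A := X \ K' ∩ L ⁻¹' {i} with hA
  set B := Y \ K' ∩ L ⁻¹' {j} with hB
  set C := {v | v ∉ A ∧ v ∉ B ∧ v ∉ K'} with hC
  have hAK : ∀ v ∈ A, v ∉ K' := fun v hv => hv.1.2
  have hBK : ∀ v ∈ B, v ∉ K' := fun v hv => hv.1.2
  have hAB : ∀ v ∈ A, v ∉ B := fun v hv hv' => hs.left_not_right v hv.1.1 hv'.1.1
  have hside : ∀ {S T : Set V}, Separation w S T K → ∀ n, ∀ a ∈ S \ K' ∩ L ⁻¹' {n},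
      ∀ b ∉ S \ K' ∩ L ⁻¹' {n}, b ∉ K' → w a b = 0 := by
    intro S T hST n a ha b hb' hbK
    by_contra hne
    have hpos : 0 < w a b := (hb.2.2.1 a b).lt_of_ne' hne
    refine hb' ⟨⟨?_, hbK⟩, (hLadj a ha.1.2 b hbK hpos).symm.trans ha.2⟩
    rcases hST.cover b with h | h | h
    · exact h
    · exact absurd (hST.noEdge a ha.1.1 b h) hne
    · exact absurd (hKK' h) hbK
  have hAe : ∀ a ∈ A, ∀ b ∉ A, b ∉ K' → w a b = 0 := hside hs i
  have hBe : ∀ a ∈ B, ∀ b ∉ B, b ∉ K' → w a b = 0 := hside (hs.symm hwsymm) j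
  have hsep : ∀ S ⊆ K'ᶜ, (∀ a ∈ S, ∀ b ∉ S, b ∉ K' → w a b = 0) → ∀ T, T = K'ᶜ \ S →
      Separation w S T K' := by
    rintro S hSK hS T rfl
    refine ⟨fun v => ?_, fun v hv hv' => hv'.2 hv, fun v hv => hSK hv, fun v hv => hv.1, hfin,
      fun a ha b hb => hS a ha b hb.2 hb.1⟩
    by_cases h1 : v ∈ S <;> by_cases h2 : v ∈ K' <;> simp [h1, h2]
  have hCi : C.Infinite := by
    refine ((hinf l).sdiff hfin).mono fun v hv => ⟨fun h => hli ?_, fun h => hlj ?_, hv.2⟩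
    · exact (hLx l v hv.1).symm.trans h.2
    · exact (hLx l v hv.1).symm.trans h.2
  have hCA : B ∪ C = K'ᶜ \ A := by
    ext v
    have := hAK v
    have := hBK v
    have := hAB v
    simp only [hC, Set.mem_union, Set.mem_sdiff, Set.mem_compl_iff]
    change (v ∈ B ∨ (v ∉ A ∧ v ∉ B ∧ v ∉ K')) ↔ _
    tauto
  have hCB : A ∪ C = K'ᶜ \ B := by
    ext v
    have := hAK v
    have := hBK v
    have := hAB v
    simp only [hC, Set.mem_union, Set.mem_sdiff, Set.mem_compl_iff]
    change (v ∈ A ∨ (v ∉ A ∧ v ∉ B ∧ v ∉ K')) ↔ _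
    tauto
  have hCC : C = K'ᶜ \ (A ∪ B) := by
    ext v
    simp only [hC, Set.mem_union, Set.mem_sdiff, Set.mem_compl_iff]
    change (v ∉ A ∧ v ∉ B ∧ v ∉ K') ↔ _
    tauto
  have hABe : ∀ a ∈ A ∪ B, ∀ b ∉ A ∪ B, b ∉ K' → w a b = 0 := by
    rintro a (ha | ha) b hb' hbK
    · exact hAe a ha b (fun h => hb' (.inl h)) hbK
    · exact hBe a ha b (fun h => hb' (.inr h)) hbK
  exact false_of_three_parts hb hk (hsep A hAK hAe _ hCA)
    ((hsep B hBK hBe _ hCB).symm hwsymm)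
    ((hsep (A ∪ B) (Set.union_subset hAK hBK) hABe _ hCC).symm hwsymm)
    hconn hne hi hj hCi

end Ends

/-- **Theorem (Every salami has two ends).** Every salami has exactly two ends. -/
theorem salami_exactly_two_ends {V : Type*} (w : V → V → ℝ) (m : V → ℝ)
    (d : V → V → ℝ) (h : IsSalami w m d) :
    atLeastEnds w 2 ∧ ¬ atLeastEnds w 3 := by
  obtain ⟨hb, hk, X, Y, K, hP⟩ := h
  exact ⟨hP.atLeastEnds_two hb, hP.not_atLeastEnds_three hb hk⟩

end SalamiPaper
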